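/- Let m ≥ 1, L ≥ 1, d = m+1, 𝒜 = {0_d, e_1, …, e_d} ⊆ ℝ^d, θ* = (1/√d, …, 1/√d), and γ ≤ 0 real, with instantaneous reward f(h, a) = ⟨a, (I_d + Σ_{s=1}^m h_s h_sᵀ)^γ θ*⟩ for h ∈ 𝒜^m, a ∈ 𝒜. Let T be a multiple of m+L and let ã ∈ 𝒜^{m+L} be the block with ã_i = 0_d for i ≤ m and ã_{m+i} = e_{((i−1) mod d)+1} for 1 ≤ i ≤ L, which maximizes the proxy reward r̃ over 𝒜^{m+L}. Then playing ã cyclically (a_t = ã_{((t−1) mod (m+L))+1}, with a_t = 0_d for t ≤ 0) yields total reward Σ_{t=1}^T r̃_t = (L/(m+L))·T/√d, so that OPT − Σ_{t=1}^T r̃_t = m T /((m+L)√d) = mRT/(m+L), where OPT = T/√d is the optimal total reward over 𝒜^T and R = 1/√d is the supremum of |f| over all histories in 𝒜^m and actions in 𝒜. -/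

import Mathlib

open Finset Matrix

/-- Real power `M^γ` of a matrix, defined via the spectral decomposition when `M` is
Hermitian (applying `t ↦ t^γ` to the eigenvalues), and junk value `0` otherwise. -/
noncomputable def matRpow {n : Type*} [Fintype n] [DecidableEq n]
    (M : Matrix n n ℝ) (γ : ℝ) : Matrix n n ℝ :=
  if hM : M.IsHermitian then
    (hM.eigenvectorUnitary : Matrix n n ℝ) *
      Matrix.diagonal (fun i => hM.eigenvalues i ^ γ) *
      star (hM.eigenvectorUnitary : Matrix n n ℝ)
  else 0

/-- Instantaneous reward at time `t` of the (zero-padded, `ℤ`-indexed) sequence `a`,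
under the reward function `f` with memory size `m`. -/
noncomputable def instReward {V : Type*} (m : ℕ) (f : (Fin m → V) → V → ℝ)
    (a : ℤ → V) (t : ℤ) : ℝ :=
  f (fun s => a (t - (m : ℤ) + (s.1 : ℤ))) (a t)

/-- Total reward of the sequence `a` over the horizon `t = 1, …, T`. -/
noncomputable def totalReward {V : Type*} (m : ℕ) (f : (Fin m → V) → V → ℝ)
    (T : ℕ) (a : ℤ → V) : ℝ :=
  ∑ t ∈ Finset.Icc (1 : ℤ) (T : ℤ), instReward m f a t

/-- Proxy reward of a block `b` (indexed by `1, …, m+L`). -/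
noncomputable def proxyReward {V : Type*} (m L : ℕ) (f : (Fin m → V) → V → ℝ)
    (b : ℕ → V) : ℝ :=
  ∑ i ∈ Finset.Icc (m + 1) (m + L), f (fun s => b (i - m + (s.1 : ℕ))) (b i)

/-- The `ℤ`-indexed sequence obtained by playing the block `b` (of length `p`)
cyclically: `a_t = b_{((t-1) mod p) + 1}` for `t ≥ 1`, and `a_t = 0` for `t ≤ 0`. -/
noncomputable def cyclicSeq {V : Type*} [Zero V] (p : ℕ) (b : ℕ → V) (t : ℤ) : V :=
  if t ≤ 0 then 0 else b (((t - 1) % (p : ℤ)).toNat + 1)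

/-- The block `ã`: `ã_i = 0` for `1 ≤ i ≤ m`, and `ã_{m+i} = e_{((i-1) mod d) + 1}`
for `1 ≤ i ≤ L`. -/
noncomputable def blockTilde (d m : ℕ) (hd : 0 < d) : ℕ → (Fin d → ℝ) := fun i =>
  if i ≤ m then 0 else Pi.single (⟨(i - m - 1) % d, Nat.mod_lt _ hd⟩ : Fin d) 1

/-- The set of achievable total rewards over horizon `T`, for zero-padded sequences
taking values in `A0` on `{1, …, T}`.  Its supremum is `OPT`. -/
noncomputable def rewardSet {V : Type*} [Zero V] (m : ℕ) (f : (Fin m → V) → V → ℝ)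
    (A0 : Set V) (T : ℕ) : Set ℝ :=
  {x | ∃ a : ℤ → V, (∀ t : ℤ, t ≤ 0 → a t = 0) ∧
    (∀ t : ℤ, 1 ≤ t → t ≤ (T : ℤ) → a t ∈ A0) ∧ x = totalReward m f T a}

theorem matRpow_diagonal {n : Type*} [Fintype n] [DecidableEq n] (v : n → ℝ) (γ : ℝ) :
    matRpow (Matrix.diagonal v) γ = Matrix.diagonal (fun i => v i ^ γ) := by
  have hM : (Matrix.diagonal v).IsHermitian := Matrix.isHermitian_diagonal v
  rw [matRpow, dif_pos hM]
  set U : Matrix n n ℝ := (hM.eigenvectorUnitary : Matrix n n ℝ) with hU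
  have hUU : U * star U = 1 := Unitary.coe_mul_star_self hM.eigenvectorUnitary
  have hspec : U * Matrix.diagonal hM.eigenvalues = Matrix.diagonal v * U := by
    ext i j
    have h := congrFun (hM.mulVec_eigenvectorBasis j) i
    rw [Matrix.mulVec_diagonal] at h
    rw [Matrix.mul_diagonal, Matrix.diagonal_mul, hU, hM.eigenvectorUnitary_apply, h]
    simp [mul_comm]
  have hpow : U * Matrix.diagonal (fun i => hM.eigenvalues i ^ γ) =
      Matrix.diagonal (fun i => v i ^ γ) * U := by
    ext i j
    have h := congrFun (congrFun hspec i) j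
    rw [Matrix.mul_diagonal, Matrix.diagonal_mul] at h ⊢
    by_cases h0 : U i j = 0
    · simp [h0]
    · have : hM.eigenvalues j = v i := mul_left_cancel₀ h0 (by rw [h, mul_comm])
      rw [this, mul_comm]
  rw [hpow, Matrix.mul_assoc, hUU, Matrix.mul_one]

/-- The zero vector together with the standard basis vectors. -/
def basisActions (d : ℕ) : Set (Fin d → ℝ) :=
  {0} ∪ Set.range (fun k : Fin d => Pi.single k (1 : ℝ))

theorem zero_mem_basisActions (d : ℕ) : 0 ∈ basisActions d := Or.inl rfl

theorem single_mem_basisActions {d : ℕ} (k : Fin d) : Pi.single k (1 : ℝ) ∈ basisActions d :=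
  Or.inr ⟨k, rfl⟩

theorem apply_nonneg_of_mem_basisActions {d : ℕ} {a : Fin d → ℝ} (ha : a ∈ basisActions d)
    (j : Fin d) : 0 ≤ a j := by
  rcases ha with rfl | ⟨k, rfl⟩
  · simp
  · exact (Pi.single_nonneg.2 zero_le_one : (0 : Fin d → ℝ) ≤ Pi.single k 1) j

theorem vecMulVec_self_of_mem_basisActions {d : ℕ} {a : Fin d → ℝ} (ha : a ∈ basisActions d) :
    vecMulVec a a = Matrix.diagonal a := by
  rcases ha with rfl | ⟨k, rfl⟩
  · ext i j
    simp [vecMulVec_apply, Matrix.diagonal_apply]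
  · ext i j
    simp only [vecMulVec_apply, Matrix.diagonal_apply, Pi.single_apply]
    grind

theorem single_dotProduct_matRpow_mulVec {d m : ℕ} {h : Fin m → (Fin d → ℝ)}
    (hh : ∀ s, h s ∈ basisActions d) (γ c : ℝ) (j : Fin d) :
    Pi.single j (1 : ℝ) ⬝ᵥ
      (matRpow (1 + ∑ s, vecMulVec (h s) (h s)) γ).mulVec (fun _ => c) =
      (1 + ∑ s, h s j) ^ γ * c := by
  have hdiag : (1 + ∑ s, vecMulVec (h s) (h s)) =
      Matrix.diagonal (fun i => 1 + ∑ s, h s i) := by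
    simp_rw [fun s => vecMulVec_self_of_mem_basisActions (hh s)]
    ext i k
    by_cases hik : i = k
    · subst hik
      simp [Matrix.sum_apply]
    · simp [Matrix.sum_apply, hik]
  rw [hdiag, matRpow_diagonal, single_dotProduct, Matrix.mulVec_diagonal, one_mul]

theorem blockTilde_mem (d m : ℕ) (hd : 0 < d) (i : ℕ) : blockTilde d m hd i ∈ basisActions d := by
  unfold blockTilde
  split_ifs
  · exact zero_mem_basisActions d
  · exact single_mem_basisActions _

theorem blockTilde_apply_eq_zero {d m : ℕ} (hd : 0 < d) (hmd : m < d) {i k : ℕ} (hki : k < i)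
    (hik : i ≤ k + m) :
    blockTilde d m hd k ⟨(i - m - 1) % d, Nat.mod_lt _ hd⟩ = 0 := by
  unfold blockTilde
  split_ifs with hk
  · rfl
  · rw [Pi.single_apply, if_neg]
    intro h
    have h' : k - m - 1 ≡ i - m - 1 [MOD d] := (Fin.mk.inj h).symm
    have h2 := (Nat.modEq_iff_dvd' (by omega)).1 h'
    have := Nat.le_of_dvd (by omega) h2
    omega

theorem sum_range_mul_mod {M : Type*} [AddCommMonoid M] (g : ℕ → M) (p q : ℕ) :
    ∑ n ∈ range (p * q), g (n % p) = q • ∑ r ∈ range p, g r := by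
  induction q with
  | zero => simp
  | succ q ih =>
    rw [Nat.mul_succ, sum_range_add, ih, succ_nsmul]
    congr 1
    refine sum_congr rfl fun r hr => ?_
    rw [Nat.mul_add_mod, Nat.mod_eq_of_lt (mem_range.1 hr)]

theorem totalReward_eq_sum_range {V : Type*} (m : ℕ) (f : (Fin m → V) → V → ℝ) (T : ℕ)
    (a : ℤ → V) : totalReward m f T a = ∑ n ∈ range T, instReward m f a ((n : ℤ) + 1) := by
  unfold totalReward
  symm
  refine sum_bij (fun n _ => (n : ℤ) + 1) ?_ ?_ ?_ ?_
  · intro n hn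
    have := mem_range.1 hn
    exact mem_Icc.2 ⟨by omega, by omega⟩
  · intro x _ y _ h
    omega
  · intro t ht
    have := mem_Icc.1 ht
    exact ⟨(t - 1).toNat, mem_range.2 (by omega), by omega⟩
  · intros
    rfl

theorem cyclicSeq_natCast_add_one {V : Type*} [Zero V] (p : ℕ) (b : ℕ → V) (n : ℕ) :
    cyclicSeq p b ((n : ℤ) + 1) = b (n % p + 1) := by
  rw [cyclicSeq, if_neg (by omega), add_sub_cancel_right, ← Int.natCast_mod, Int.toNat_natCast]

theorem instReward_cyclicSeq {V : Type*} [Zero V] {m p : ℕ} (f : (Fin m → V) → V → ℝ)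
    (b : ℕ → V) {n : ℕ} (hp : 0 < p) (hn : m ≤ n % p) :
    instReward m f (cyclicSeq p b) ((n : ℤ) + 1) =
      f (fun s => b (n % p + 1 - m + s.1)) (b (n % p + 1)) := by
  unfold instReward
  rw [cyclicSeq_natCast_add_one]
  congr 1
  funext s
  have hs := s.2
  have hlt := Nat.mod_lt n hp
  have hdm := Nat.div_add_mod n p
  have hcast : (n : ℤ) + 1 - m + (s.1 : ℤ) = ((p * (n / p) + (n % p - m + s.1) : ℕ) : ℤ) + 1 := by
    omega
  rw [hcast, cyclicSeq_natCast_add_one, Nat.mul_add_mod, Nat.mod_eq_of_lt (by omega)]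
  congr 1
  omega

/-- tightness of the approximation: in the LBM with `d = m+1`,
actions `{0, e_1, …, e_d}`, `θ* = (1/√d, …, 1/√d)` and exponent `γ ≤ 0`, the block `ã`
maximizes the proxy reward, playing it cyclically over a horizon `T` divisible by `m+L`
yields total reward `(L/(m+L))·T/√d`, the optimal total reward is `OPT = T/√d`, the
supremum of `|f|` is `R = 1/√d`, and `OPT` minus the cyclic reward equals
`mT/((m+L)√d) = mRT/(m+L)`. -/
theorem stmt_3 (m L T : ℕ) (hm : 1 ≤ m) (hL : 1 ≤ L) (hT : 0 < T)
    (hdvd : (m + L) ∣ T) (γ : ℝ) (hγ : γ ≤ 0)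
    (d : ℕ) (hd : d = m + 1)
    (𝒜 : Set (Fin d → ℝ))
    (h𝒜 : 𝒜 = {0} ∪ Set.range (fun k : Fin d => Pi.single k (1 : ℝ)))
    (θstar : Fin d → ℝ) (hθ : θstar = fun _ => 1 / Real.sqrt d)
    (f : (Fin m → (Fin d → ℝ)) → (Fin d → ℝ) → ℝ)
    (hf : ∀ (h : Fin m → (Fin d → ℝ)) (a : Fin d → ℝ),
      f h a = a ⬝ᵥ (matRpow (1 + ∑ s, vecMulVec (h s) (h s)) γ).mulVec θstar) :
    (∀ b : ℕ → (Fin d → ℝ), (∀ i ∈ Finset.Icc 1 (m + L), b i ∈ 𝒜) →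
        proxyReward m L f b ≤ proxyReward m L f (blockTilde d m (by omega))) ∧
    totalReward m f T (cyclicSeq (m + L) (blockTilde d m (by omega))) =
      ((L : ℝ) / ((m : ℝ) + (L : ℝ))) * ((T : ℝ) / Real.sqrt d) ∧
    sSup (rewardSet m f 𝒜 T) = (T : ℝ) / Real.sqrt d ∧
    sSup {x : ℝ | ∃ (h : Fin m → (Fin d → ℝ)) (a : Fin d → ℝ),
        (∀ s, h s ∈ 𝒜) ∧ a ∈ 𝒜 ∧ x = |f h a|} = 1 / Real.sqrt d ∧
    sSup (rewardSet m f 𝒜 T) -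
        totalReward m f T (cyclicSeq (m + L) (blockTilde d m (by omega))) =
      (m : ℝ) * (T : ℝ) / (((m : ℝ) + (L : ℝ)) * Real.sqrt d) := by
  have hd0 : 0 < d := by omega
  have hmd : m < d := by omega
  obtain rfl : 𝒜 = basisActions d := h𝒜
  subst hθ
  set c : ℝ := 1 / Real.sqrt d with hc
  have hsqrt : 0 < Real.sqrt d := Real.sqrt_pos.2 (by exact_mod_cast hd0)
  have hc0 : 0 ≤ c := by positivity
  have hzero : ∀ h, f h 0 = 0 := fun h => by rw [hf, zero_dotProduct]
  have hbound : ∀ h a, (∀ s, h s ∈ basisActions d) → a ∈ basisActions d →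
      0 ≤ f h a ∧ f h a ≤ c := by
    rintro h a hh (rfl | ⟨j, rfl⟩)
    · rw [hzero]
      exact ⟨le_rfl, hc0⟩
    · have hsum : 0 ≤ ∑ s, h s j :=
        sum_nonneg fun s _ => apply_nonneg_of_mem_basisActions (hh s) j
      rw [hf, single_dotProduct_matRpow_mulVec hh]
      exact ⟨by positivity,
        mul_le_of_le_one_left hc0 (Real.rpow_le_one_of_one_le_of_nonpos (by linarith) hγ)⟩
  have hfresh : ∀ h j, (∀ s, h s ∈ basisActions d) → (∀ s, h s j = 0) →
      f h (Pi.single j 1) = c := by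
    intro h j hh hj
    rw [hf, single_dotProduct_matRpow_mulVec hh]
    simp [hj]
  have hblock : ∀ (k : Fin m → ℕ) (i : ℕ), m < i → (∀ s, k s < i ∧ i ≤ k s + m) →
      f (fun s => blockTilde d m hd0 (k s)) (blockTilde d m hd0 i) = c := by
    intro k i hi hk
    have hval : blockTilde d m hd0 i = Pi.single ⟨(i - m - 1) % d, Nat.mod_lt _ hd0⟩ 1 :=
      if_neg (by omega)
    rw [hval]
    exact hfresh _ _ (fun s => blockTilde_mem d m hd0 _)
      fun s => blockTilde_apply_eq_zero hd0 hmd (hk s).1 (hk s).2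
  have hproxy : ∀ b : ℕ → (Fin d → ℝ), (∀ i ∈ Finset.Icc 1 (m + L), b i ∈ basisActions d) →
      proxyReward m L f b ≤ proxyReward m L f (blockTilde d m hd0) := by
    intro b hb
    refine sum_le_sum fun i hi => ?_
    have hi := mem_Icc.1 hi
    rw [hblock _ i (by omega) fun s => by have := s.2; omega]
    refine (hbound _ _ (fun s => hb _ (mem_Icc.2 ?_)) (hb _ (mem_Icc.2 ?_))).2
    · have := s.2
      omega
    · omega
  have hcyc : totalReward m f T (cyclicSeq (m + L) (blockTilde d m hd0)) =
      ((L : ℝ) / ((m : ℝ) + (L : ℝ))) * ((T : ℝ) / Real.sqrt d) := by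
    have hterm : ∀ n : ℕ,
        instReward m f (cyclicSeq (m + L) (blockTilde d m hd0)) ((n : ℤ) + 1) =
          if n % (m + L) < m then 0 else c := by
      intro n
      split_ifs with hn
      · rw [instReward, cyclicSeq_natCast_add_one]
        have hval : blockTilde d m hd0 (n % (m + L) + 1) = 0 := if_pos (by omega)
        rw [hval, hzero]
      · rw [instReward_cyclicSeq f _ (by omega) (by omega)]
        exact hblock _ _ (by omega) fun s => by have := s.2; omega
    obtain ⟨q, rfl⟩ := hdvd
    rw [totalReward_eq_sum_range, sum_congr rfl fun n _ => hterm n,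
      sum_range_mul_mod (fun r => if r < m then 0 else c), sum_range_add,
      sum_eq_zero fun r hr => if_pos (mem_range.1 hr),
      sum_congr rfl fun r _ => if_neg (by omega : ¬ m + r < m)]
    have hmL : (0 : ℝ) < (m : ℝ) + L := by positivity
    simp only [sum_const, card_range, nsmul_eq_mul, zero_add, hc]
    push_cast
    field_simp
  have hopt : sSup (rewardSet m f (basisActions d) T) = (T : ℝ) / Real.sqrt d := by
    refine IsGreatest.csSup_eq ⟨?_, ?_⟩
    · refine ⟨fun t => blockTilde d m hd0 (t.toNat + m), fun t ht => if_pos (by omega),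
        fun t _ _ => blockTilde_mem d m hd0 _, ?_⟩
      have hterm : ∀ n : ℕ, instReward m f (fun t : ℤ => blockTilde d m hd0 (t.toNat + m))
          ((n : ℤ) + 1) = c := fun n =>
        hblock _ _ (by omega) fun s => by have := s.2; omega
      rw [totalReward_eq_sum_range, sum_congr rfl fun n _ => hterm n]
      simp [hc, div_eq_mul_inv]
    · rintro _ ⟨a, ha0, ha, rfl⟩
      have hmem : ∀ t : ℤ, t ≤ T → a t ∈ basisActions d := by
        intro t ht
        rcases le_or_gt t 0 with h0 | h0
        · rw [ha0 t h0]
          exact zero_mem_basisActions d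
        · exact ha t h0 ht
      rw [totalReward_eq_sum_range]
      refine (sum_le_card_nsmul _ _ c fun n hn => ?_).trans_eq
        (by simp [hc, div_eq_mul_inv])
      have := mem_range.1 hn
      refine (hbound _ _ (fun s => hmem _ ?_) (hmem _ (by omega))).2
      have := s.2
      omega
  refine ⟨hproxy, hcyc, hopt, IsGreatest.csSup_eq ⟨?_, ?_⟩, ?_⟩
  · refine ⟨fun _ => 0, Pi.single ⟨0, hd0⟩ 1, fun _ => zero_mem_basisActions d,
      single_mem_basisActions _, ?_⟩
    rw [hfresh _ _ (fun _ => zero_mem_basisActions d) (fun _ => rfl), abs_of_nonneg hc0]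
  · rintro _ ⟨h, a, hh, ha, rfl⟩
    rw [abs_of_nonneg (hbound h a hh ha).1]
    exact (hbound h a hh ha).2
  · rw [hopt, hcyc]
    have hmL : (0 : ℝ) < (m : ℝ) + L := by positivity
    field_simp
    ring
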